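/- arXiv:1108.5237 — 2 statements merged into one kernel-verified Lean document; each statement's English description precedes it below -/
import Mathlib

section
/- Let X be a complex Banach space and let F : ℝ → X be absolutely regular with F(t) = 0 for almost every t < 0, and let 𝓛F(λ) = ∫₀^∞ e^{−λt} F(t) dt for Re λ > 0. Call ω ∈ ℝ a weakly regular point for 𝓛F if there exist ε > 0 and a Bochner integrable h : (ω−ε, ω+ε) → X such that for every smooth compactly supported φ : ℝ → ℂ with support contained in (ω−ε, ω+ε), lim_{a↓0} ∫_ℝ φ(s)·𝓛F(a+is) ds = ∫_{ω−ε}^{ω+ε} φ(s)·h(s) ds. Then every weakly regular point ω for 𝓛F admits a Schwartz function φ with φ̂(ω) ≠ 0 such that ‖(F∗φ)(t)‖ → 0 as t → +∞; equivalently, the reduced spectrum sp_{C₀(ℝ₊,X),𝒮}(F) is contained in the weak Laplace spectrum sp^{w𝓛}(F). -/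
open MeasureTheory Filter Topology

/-- The Fourier transform `f̂(ω) = ∫ e^{-iωt} f(t) dt` of an integrable function. -/
noncomputable def fourierInt (f : ℝ → ℂ) (ω : ℝ) : ℂ :=
  ∫ t : ℝ, Complex.exp (-(Complex.I * ω * t)) * f t

/-- A function `F : ℝ → X` is absolutely regular: strongly measurable, locally Bochner
integrable, and `t ↦ φ(t) • F(t)` is Bochner integrable for every Schwartz `φ`. -/
def AbsolutelyRegular {X : Type*} [NormedAddCommGroup X] [NormedSpace ℂ X]
    (F : ℝ → X) : Prop :=
  StronglyMeasurable F ∧ LocallyIntegrable F ∧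
    ∀ φ : SchwartzMap ℝ ℂ, Integrable (fun t => φ t • F t)

/-- The convolution `(F∗φ)(t) = ∫ φ(t−s) • F(s) ds`. -/
noncomputable def convS {X : Type*} [NormedAddCommGroup X] [NormedSpace ℂ X]
    (φ : ℝ → ℂ) (F : ℝ → X) (t : ℝ) : X :=
  ∫ s : ℝ, φ (t - s) • F s

/-- The Laplace transform `𝓛F(λ) = ∫₀^∞ e^{−λt} F(t) dt`. -/
noncomputable def laplaceT {X : Type*} [NormedAddCommGroup X] [NormedSpace ℂ X]
    (F : ℝ → X) (l : ℂ) : X :=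
  ∫ t in Set.Ioi (0:ℝ), Complex.exp (-l * t) • F t

/-- `ω` is a weakly regular point for `𝓛F`: there are `ε > 0` and an integrable
`h : (ω−ε,ω+ε) → X` such that for every test function `φ` supported in `(ω−ε,ω+ε)`,
`lim_{a↓0} ∫ φ(s) • 𝓛F(a+is) ds = ∫ φ(s) • h(s) ds`. -/
def WeaklyLaplaceRegularAt {X : Type*} [NormedAddCommGroup X] [NormedSpace ℂ X]
    (F : ℝ → X) (ω : ℝ) : Prop :=
  ∃ ε : ℝ, 0 < ε ∧ ∃ h : ℝ → X, IntegrableOn h (Set.Ioo (ω - ε) (ω + ε)) ∧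
    ∀ φ : ℝ → ℂ, ContDiff ℝ (⊤ : ℕ∞) φ → HasCompactSupport φ →
      tsupport φ ⊆ Set.Ioo (ω - ε) (ω + ε) →
      Tendsto (fun a : ℝ => ∫ s : ℝ, φ s • laplaceT F (↑a + Complex.I * ↑s))
        (𝓝[>] (0:ℝ)) (𝓝 (∫ s in Set.Ioo (ω - ε) (ω + ε), φ s • h s))

section ExpDecay

open scoped ContDiff Nat

lemma iteratedFDeriv_exp_comp_le {f : ℝ → ℝ} (hf : ContDiff ℝ ∞ f) (n : ℕ) (x D : ℝ)
    (hD : ∀ i, 1 ≤ i → i ≤ n → ‖iteratedFDeriv ℝ i f x‖ ≤ D ^ i) :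
    ‖iteratedFDeriv ℝ n (Real.exp ∘ f) x‖ ≤ n ! * Real.exp (f x) * D ^ n := by
  refine norm_iteratedFDeriv_comp_le Real.contDiff_exp hf (mod_cast le_top) x (fun i _ => ?_) hD
  rw [norm_iteratedFDeriv_eq_norm_iteratedDeriv, iteratedDeriv_eq_iterate, Real.iter_deriv_exp,
    Real.norm_of_nonneg (Real.exp_pos _).le]

lemma one_add_norm_pow_mul_exp_le {a : ℝ} (ha : 0 < a) (m : ℕ) (x : ℝ) :
    (1 + ‖x‖) ^ m * Real.exp (-a * (1 + ‖x‖ ^ 2) ^ (1 / 2 : ℝ)) ≤ 2 ^ m * m ! / a ^ m := by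
  rw [← Real.sqrt_eq_rpow]
  set q := √(1 + ‖x‖ ^ 2)
  have hq : 0 < q := Real.sqrt_pos.2 (by positivity)
  have hx : 1 + ‖x‖ ≤ 2 * q := by
    have h1 : 1 ≤ q := Real.one_le_sqrt.2 (le_add_of_nonneg_right (by positivity))
    have h2 : ‖x‖ ≤ q := Real.le_sqrt_of_sq_le (by linarith)
    linarith
  have hexp := Real.pow_div_factorial_le_exp (a * q) (by positivity) m
  calc (1 + ‖x‖) ^ m * Real.exp (-a * q) ≤ (2 * q) ^ m * Real.exp (-a * q) := by gcongr
    _ = 2 ^ m * m ! / a ^ m * ((a * q) ^ m / m !) * Real.exp (-a * q) := by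
        rw [mul_pow, mul_pow]
        field_simp
    _ ≤ 2 ^ m * m ! / a ^ m * Real.exp (a * q) * Real.exp (-a * q) := by gcongr
    _ = 2 ^ m * m ! / a ^ m := by
        rw [mul_assoc, ← Real.exp_add]
        simp

/-- The Schwartz function `x ↦ exp (-a √(1 + x²))`. -/
noncomputable def expNegBracket (a : ℝ) (ha : 0 < a) : SchwartzMap ℝ ℝ where
  toFun := Real.exp ∘ fun x => -a * (1 + ‖x‖ ^ 2) ^ (1 / 2 : ℝ)
  smooth' := by
    have hf : (fun x : ℝ => -a * (1 + ‖x‖ ^ 2) ^ (1 / 2 : ℝ)).HasTemperateGrowth := by fun_prop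
    exact Real.contDiff_exp.comp hf.1
  decay' k n := by
    have hf : (fun x : ℝ => -a * (1 + ‖x‖ ^ 2) ^ (1 / 2 : ℝ)).HasTemperateGrowth := by fun_prop
    obtain ⟨l, C, hC, hbound⟩ := hf.norm_iteratedFDeriv_le_uniform n
    refine ⟨n ! * (C + 1) ^ n * (2 ^ (k + l * n) * (k + l * n)! / a ^ (k + l * n)), fun x => ?_⟩
    have hD (i) (hi : 1 ≤ i) (hin : i ≤ n) :
        ‖iteratedFDeriv ℝ i (fun x : ℝ => -a * (1 + ‖x‖ ^ 2) ^ (1 / 2 : ℝ)) x‖ ≤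
          ((C + 1) * (1 + ‖x‖) ^ l) ^ i := by
      refine (hbound i hin x).trans ?_
      have h1 : 1 ≤ (1 + ‖x‖) ^ l := one_le_pow₀ (by simp)
      calc C * (1 + ‖x‖) ^ l ≤ (C + 1) * (1 + ‖x‖) ^ l := by gcongr; simp
        _ ≤ _ := le_self_pow₀ (one_le_mul_of_one_le_of_one_le (by linarith) h1) (by omega)
    grw [iteratedFDeriv_exp_comp_le hf.1 n x _ hD, ← one_add_norm_pow_mul_exp_le ha _ x]
    have hx : ‖x‖ ^ k ≤ (1 + ‖x‖) ^ k := by gcongr; simp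
    grw [hx]
    rw [mul_pow, pow_add, pow_mul]
    exact le_of_eq (by ring)

end ExpDecay

section AbelMeans

open scoped FourierTransform

variable {X : Type*} [NormedAddCommGroup X] [NormedSpace ℂ X]

lemma AbsolutelyRegular.integrableOn_exp_smul {F : ℝ → X} (hF : AbsolutelyRegular F) {a : ℝ}
    (ha : 0 < a) :
    IntegrableOn (fun s : ℝ => (Real.exp (-a * s) : ℂ) • F s) (Set.Ioi 0) := by
  have hint := (hF.2.2 ((expNegBracket a ha).postcompCLM Complex.ofRealCLM)).norm.const_mul
    (Real.exp a)
  refine hint.integrableOn.mono' (((by fun_prop : Continuous fun s : ℝ =>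
    (Real.exp (-a * s) : ℂ)).stronglyMeasurable.smul hF.1).aestronglyMeasurable) ?_
  filter_upwards [ae_restrict_mem measurableSet_Ioi] with s hs
  have hs : 0 < s := hs
  have h : (expNegBracket a ha) s = Real.exp (-a * (1 + ‖s‖ ^ 2) ^ (1 / 2 : ℝ)) := rfl
  simp only [norm_smul, Complex.norm_real, SchwartzMap.postcompCLM_apply, Complex.ofRealCLM_apply,
    h, Real.norm_of_nonneg (Real.exp_pos _).le]
  rw [← mul_assoc, ← Real.exp_add, ← Real.sqrt_eq_rpow]
  have hsq : √(1 + ‖s‖ ^ 2) ≤ 1 + s := by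
    rw [Real.norm_of_nonneg hs.le]
    exact Real.sqrt_le_iff.2 ⟨by linarith, by nlinarith⟩
  gcongr
  nlinarith

lemma AbsolutelyRegular.integrable_sub_smul {F : ℝ → X} (hF : AbsolutelyRegular F)
    (φ : SchwartzMap ℝ ℂ) (t : ℝ) : Integrable (fun s => φ (t - s) • F s) := by
  have hg : (fun s : ℝ => t - s).HasTemperateGrowth := by fun_prop
  exact hF.2.2 (SchwartzMap.compCLMOfAntilipschitz ℂ hg (K := 1)
    (AntilipschitzWith.of_le_mul_dist fun x y => by
      simp only [Real.dist_eq, sub_sub_sub_cancel_left, abs_sub_comm y x, NNReal.coe_one,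
        one_mul, le_refl]) φ)

/-- For `F` vanishing on the negative half-line, `(F∗φ)(t)` is the limit of its Abel means. -/
lemma AbsolutelyRegular.tendsto_integral_exp_smul_convS {F : ℝ → X} (hF : AbsolutelyRegular F)
    (hneg : ∀ᵐ t : ℝ, t < 0 → F t = 0) (φ : SchwartzMap ℝ ℂ) (t : ℝ) :
    Tendsto (fun a : ℝ => ∫ s in Set.Ioi (0 : ℝ), φ (t - s) • ((Real.exp (-a * s) : ℂ) • F s))
      (𝓝[>] 0) (𝓝 (convS φ F t)) := by
  have hconv : convS φ F t = ∫ s in Set.Ioi (0 : ℝ), φ (t - s) • F s := by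
    rw [convS, ← integral_Ici_eq_integral_Ioi]
    refine (setIntegral_eq_integral_of_ae_compl_eq_zero ?_).symm
    filter_upwards [hneg] with s hs hs'
    rw [hs (not_le.1 hs'), smul_zero]
  rw [hconv]
  refine tendsto_integral_filter_of_dominated_convergence (fun s => ‖φ (t - s) • F s‖)
    (Eventually.of_forall fun a => ?_) ?_ (hF.integrable_sub_smul φ t).norm.integrableOn
    (ae_of_all _ fun s => ?_)
  · have hc : Continuous fun s : ℝ => φ (t - s) := φ.continuous.comp (by fun_prop)
    exact (hc.stronglyMeasurable.smul ((by fun_prop : Continuous fun s : ℝ =>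
      (Real.exp (-a * s) : ℂ)).stronglyMeasurable.smul hF.1)).aestronglyMeasurable
  · filter_upwards [self_mem_nhdsWithin] with a ha
    filter_upwards [ae_restrict_mem measurableSet_Ioi] with s hs
    have hs : 0 < s := hs
    have ha : 0 < a := ha
    rw [norm_smul, norm_smul, norm_smul, Complex.norm_real,
      Real.norm_of_nonneg (Real.exp_pos _).le]
    gcongr
    exact mul_le_of_le_one_left (norm_nonneg _) (Real.exp_le_one_iff.2 (by nlinarith))
  · have hc : Continuous fun a : ℝ => φ (t - s) • ((Real.exp (-a * s) : ℂ) • F s) := by fun_prop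
    simpa using (hc.tendsto 0).mono_left nhdsWithin_le_nhds

/-- The Schwartz function `x ↦ ∫ e^{iux} ψ(u) du`. -/
noncomputable def angularFourierInv (ψ : SchwartzMap ℝ ℂ) : SchwartzMap ℝ ℂ :=
  SchwartzMap.compCLMOfContinuousLinearEquiv ℂ
    (ContinuousLinearEquiv.unitsEquivAut ℝ (Units.mk0 (2 * Real.pi)⁻¹ (by positivity))) (𝓕⁻ ψ)

lemma angularFourierInv_apply (ψ : SchwartzMap ℝ ℂ) (x : ℝ) :
    angularFourierInv ψ x = (𝓕⁻ ψ) (x * (2 * Real.pi)⁻¹) := rfl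

lemma angularFourierInv_eq_integral (ψ : SchwartzMap ℝ ℂ) (x : ℝ) :
    angularFourierInv ψ x = ∫ u : ℝ, Complex.exp (Complex.I * u * x) * ψ u := by
  rw [angularFourierInv_apply, SchwartzMap.fourierInv_coe, Real.fourierInv_eq']
  refine integral_congr_ae (ae_of_all _ fun u => ?_)
  have hpi : (Real.pi : ℂ) ≠ 0 := mod_cast Real.pi_ne_zero
  simp only [smul_eq_mul, RCLike.inner_apply, conj_trivial]
  congr 2
  push_cast
  field_simp

lemma fourierInt_angularFourierInv (ψ : SchwartzMap ℝ ℂ) (ω : ℝ) :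
    fourierInt (angularFourierInv ψ) ω = 2 * Real.pi * ψ ω := by
  have hpi : (Real.pi : ℂ) ≠ 0 := mod_cast Real.pi_ne_zero
  have h := congrArg (fun f : SchwartzMap ℝ ℂ => f ω) 
    (FourierTransform.fourier_fourierInv_eq (F := SchwartzMap ℝ ℂ) ψ)
  simp only [SchwartzMap.fourier_coe, Real.fourier_real_eq_integral_exp_smul] at h
  rw [← h, fourierInt]
  have := Measure.integral_comp_mul_right (fun s : ℝ =>
    Complex.exp (↑(-2 * Real.pi * s * ω) * Complex.I) • (𝓕⁻ ψ) s) (2 * Real.pi)⁻¹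
  rw [inv_inv, abs_of_pos Real.two_pi_pos, Complex.real_smul] at this
  push_cast at this
  push_cast
  rw [← this]
  refine integral_congr_ae (ae_of_all _ fun t => ?_)
  simp only [angularFourierInv_apply, smul_eq_mul]
  congr 2
  field_simp

/-- Fubini's theorem for the Abel means of `F∗φ` when `φ` is an inverse Fourier transform. -/
lemma AbsolutelyRegular.integral_exp_smul_eq_laplaceT [CompleteSpace X] {F : ℝ → X}
    (hF : AbsolutelyRegular F) (ψ : SchwartzMap ℝ ℂ) (t : ℝ) {a : ℝ} (ha : 0 < a) :
    ∫ s in Set.Ioi (0 : ℝ), angularFourierInv ψ (t - s) • ((Real.exp (-a * s) : ℂ) • F s) =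
      ∫ u : ℝ, (Complex.exp (Complex.I * u * t) * ψ u) • laplaceT F (a + Complex.I * u) := by
  have hG := hF.integrableOn_exp_smul ha
  have hprod : Integrable (Function.uncurry fun (s u : ℝ) =>
      (Complex.exp (Complex.I * u * ((t - s : ℝ) : ℂ)) * ψ u) • ((Real.exp (-a * s) : ℂ) • F s))
      ((volume.restrict (Set.Ioi 0)).prod volume) := by
    have hint := ((ψ.integrable (μ := volume)).smul_prod hG).swap
    have hcont : Continuous fun p : ℝ × ℝ =>
        Complex.exp (Complex.I * p.2 * ((t - p.1 : ℝ) : ℂ)) := by fun_prop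
    refine (hint.bdd_smul 1 hcont.aestronglyMeasurable (ae_of_all _ fun p => ?_)).congr
      (ae_of_all _ fun p => ?_)
    · simp [Complex.norm_exp]
    · simp [Function.uncurry, smul_smul, mul_assoc]
  calc _ = ∫ s in Set.Ioi (0 : ℝ), ∫ u : ℝ, (Complex.exp (Complex.I * u * ((t - s : ℝ) : ℂ)) * ψ u)
        • ((Real.exp (-a * s) : ℂ) • F s) := by
        simp_rw [angularFourierInv_eq_integral, integral_smul_const]
    _ = ∫ u : ℝ, ∫ s in Set.Ioi (0 : ℝ), (Complex.exp (Complex.I * u * ((t - s : ℝ) : ℂ)) * ψ u)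
        • ((Real.exp (-a * s) : ℂ) • F s) := integral_integral_swap hprod
    _ = _ := by
        refine integral_congr_ae (ae_of_all _ fun u => ?_)
        simp only [laplaceT]
        rw [← integral_smul]
        refine integral_congr_ae (ae_of_all _ fun s => ?_)
        simp only [smul_smul]
        congr 1
        rw [mul_right_comm, mul_right_comm _ (ψ u)]
        push_cast
        rw [← Complex.exp_add, ← Complex.exp_add]
        ring_nf

lemma tendsto_setIntegral_exp_mul_smul (S : Set ℝ) (hS : MeasurableSet S) (ψ : ℝ → ℂ)
    (h : ℝ → X) :
    Tendsto (fun t : ℝ => ∫ u in S, (Complex.exp (Complex.I * u * t) * ψ u) • h u) atTop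
      (𝓝 0) := by
  have hRL := Real.tendsto_integral_exp_smul_cocompact (S.indicator fun u => ψ u • h u)
  have ht : Tendsto (fun t : ℝ => -(t * (2 * Real.pi)⁻¹)) atTop (cocompact ℝ) :=
    (tendsto_neg_atTop_atBot.comp (tendsto_id.atTop_mul_const
      (inv_pos.2 Real.two_pi_pos))).mono_right atBot_le_cocompact
  refine (hRL.comp ht).congr fun t => ?_
  rw [← integral_indicator hS]
  refine integral_congr_ae (ae_of_all _ fun u => ?_)
  have hpi : (Real.pi : ℂ) ≠ 0 := mod_cast Real.pi_ne_zero
  by_cases hu : u ∈ S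
  · simp only [hu, Set.indicator_of_mem, Circle.smul_def, Real.fourierChar_apply, smul_smul]
    congr 3
    push_cast
    field_simp
  · simp [hu]

end AbelMeans

/-- For `F` absolutely regular and vanishing a.e. on the negative half-line,
every weakly regular point `ω` of `𝓛F` admits a Schwartz `φ` with `φ̂(ω) ≠ 0` such that
`‖(F∗φ)(t)‖ → 0` as `t → +∞`; i.e. `sp_{C₀(ℝ₊,X),𝒮}(F) ⊆ sp^{w𝓛}(F)`. -/
theorem reduced_spectrum_subset_weak_laplace {X : Type*} [NormedAddCommGroup X]
    [NormedSpace ℂ X] [CompleteSpace X] (F : ℝ → X) (hF : AbsolutelyRegular F)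
    (hneg : ∀ᵐ t : ℝ, t < 0 → F t = 0) :
    ∀ ω : ℝ, WeaklyLaplaceRegularAt F ω →
      ∃ φ : SchwartzMap ℝ ℂ, fourierInt (⇑φ) ω ≠ 0 ∧
        Tendsto (fun t => ‖convS (⇑φ) F t‖) atTop (𝓝 0) := by
  rintro ω ⟨ε, hε, h, -, hlim⟩
  let b : ContDiffBump ω := ⟨ε / 4, ε / 2, by linarith, by linarith⟩
  have hsmooth : ContDiff ℝ (⊤ : ℕ∞) fun u => (b u : ℂ) := Complex.ofRealCLM.contDiff.comp b.contDiff
  have hsupp : HasCompactSupport fun u => (b u : ℂ) :=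
    b.hasCompactSupport.comp_left Complex.ofReal_zero
  let ψ : SchwartzMap ℝ ℂ := hsupp.toSchwartzMap hsmooth
  have hsub : tsupport ψ ⊆ Set.Ioo (ω - ε) (ω + ε) := by
    refine (tsupport_comp_subset Complex.ofReal_zero b).trans ?_
    rw [b.tsupport_eq, ← Real.ball_eq_Ioo]
    exact Metric.closedBall_subset_ball (half_lt_self hε)
  have hconv (t : ℝ) : convS (angularFourierInv ψ) F t =
      ∫ u in Set.Ioo (ω - ε) (ω + ε), (Complex.exp (Complex.I * u * t) * ψ u) • h u := by
    refine tendsto_nhds_unique (hF.tendsto_integral_exp_smul_convS hneg _ t) ?_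
    refine (hlim (fun u => Complex.exp (Complex.I * u * t) * ψ u) ?_ hsupp.mul_left
      ((tsupport_mul_subset_right).trans hsub)).congr' ?_
    · have := Complex.ofRealCLM.contDiff (n := (⊤ : ℕ∞))
      exact (Complex.contDiff_exp.comp ((contDiff_const.mul this).mul contDiff_const)).mul hsmooth
    · filter_upwards [self_mem_nhdsWithin] with a ha
      exact (hF.integral_exp_smul_eq_laplaceT ψ t ha).symm
  refine ⟨angularFourierInv ψ, ?_, ?_⟩
  · have hψ : ψ ω = 1 := by
      change (b ω : ℂ) = 1
      simp [b.one_of_mem_closedBall (Metric.mem_closedBall_self b.rIn_pos.le)]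
    simp [fourierInt_angularFourierInv, hψ, Real.pi_ne_zero]
  · simp_rw [hconv]
    exact (tendsto_setIntegral_exp_mul_smul _ measurableSet_Ioo ψ h).norm.trans (by simp)
end

section
/- Let X be a complex Banach space and let F : ℝ → X be absolutely regular with F(t) = 0 for almost every t < 0. Suppose 0 is a regular point for the Laplace transform 𝓛F(λ) = ∫₀^∞ e^{−λt} F(t) dt, i.e. there exist an open neighbourhood U of 0 in ℂ and a holomorphic g : U → X with g(λ) = 𝓛F(λ) for all λ ∈ U with Re λ > 0. If the indefinite integral PF(t) = ∫₀^t F(s) ds is uniformly continuous on [0,∞), then PF is bounded on [0,∞) and F is ergodic on ℝ₊ with mean 0, i.e. sup_{t≥0} ‖(1/T)∫₀^T F(t+s) ds‖ → 0 as T → ∞. -/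
open MeasureTheory Filter Topology

/-- `ω ∈ ℝ` is a regular point for `𝓛F`: there are an open neighbourhood `U` of `iω` and a
holomorphic `g : U → X` agreeing with `𝓛F` on `U ∩ {Re λ > 0}`. -/
def LaplaceRegularAt {X : Type*} [NormedAddCommGroup X] [NormedSpace ℂ X]
    (F : ℝ → X) (ω : ℝ) : Prop :=
  ∃ U : Set ℂ, IsOpen U ∧ Complex.I * ω ∈ U ∧ ∃ g : ℂ → X,
    DifferentiableOn ℂ g U ∧ ∀ l ∈ U, 0 < l.re → g l = laplaceT F l

/-- The Laplace spectrum: the set of `ω ∈ ℝ` which are not regular points for `𝓛F`. -/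
def laplaceSpectrum {X : Type*} [NormedAddCommGroup X] [NormedSpace ℂ X]
    (F : ℝ → X) : Set ℝ :=
  {ω : ℝ | ¬ LaplaceRegularAt F ω}

open Polynomial in
/-- Every iterated derivative of `t ↦ (cosh (x t))⁻¹` is a polynomial in `tanh (x t)` times
the function itself. -/
lemma exists_iteratedDeriv_inv_cosh_eq (x : ℝ) (n : ℕ) :
    ∃ P : ℝ[X], iteratedDeriv n (fun t : ℝ => (Real.cosh (x * t))⁻¹) =
      fun t => P.eval (Real.tanh (x * t)) * (Real.cosh (x * t))⁻¹ := by
  induction n with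
  | zero => exact ⟨1, by simp⟩
  | succ n ih =>
    obtain ⟨P, hP⟩ := ih
    refine ⟨C x * (derivative P * (1 - X ^ 2) - P * X), ?_⟩
    rw [iteratedDeriv_succ, hP]
    funext t
    have hc : Real.cosh (x * t) ≠ 0 := (Real.cosh_pos _).ne'
    have hx : HasDerivAt (fun t : ℝ => x * t) x t := by
      simpa using (hasDerivAt_id t).const_mul x
    have hcosh := hx.cosh
    have hsinh := hx.sinh
    have htanh : HasDerivAt (fun t : ℝ => Real.tanh (x * t))
        (x * (1 - Real.tanh (x * t) ^ 2)) t := by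
      have h := hsinh.div hcosh hc
      have hfun : (fun t : ℝ => Real.tanh (x * t)) =
          (fun t : ℝ => Real.sinh (x * t)) / fun t => Real.cosh (x * t) := by
        funext s; simp [Real.tanh_eq_sinh_div_cosh]
      rw [hfun]
      refine h.congr_deriv ?_
      rw [Real.tanh_eq_sinh_div_cosh]
      field_simp
    have h := ((P.hasDerivAt _).comp t htanh).mul (hcosh.inv hc)
    refine (h.deriv).trans ?_
    simp only [eval_mul, eval_C, eval_sub, eval_one, eval_pow, eval_X, Function.comp, Pi.inv_apply]
    rw [Real.tanh_eq_sinh_div_cosh]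
    field_simp
    ring

/-- The function `t ↦ (cosh (x t))⁻¹` is a Schwartz function for `x > 0`. -/
noncomputable def invCoshSchwartz (x : ℝ) (hx : 0 < x) : SchwartzMap ℝ ℝ where
  toFun t := (Real.cosh (x * t))⁻¹
  smooth' := by
    refine ContDiff.inv ?_ fun t => (Real.cosh_pos _).ne'
    exact Real.contDiff_cosh.comp (contDiff_const.mul contDiff_id)
  decay' k n := by
    obtain ⟨P, hP⟩ := exists_iteratedDeriv_inv_cosh_eq x n
    obtain ⟨B, hB⟩ := (isCompact_Icc (a := (-1 : ℝ)) (b := 1)).exists_bound_of_continuousOn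
      P.continuous.continuousOn
    refine ⟨(x ^ k)⁻¹ * (2 * (k.factorial : ℝ)) * B, fun t => ?_⟩
    rw [norm_iteratedFDeriv_eq_norm_iteratedDeriv, hP]
    have htanh : Real.tanh (x * t) ∈ Set.Icc (-1 : ℝ) 1 :=
      ⟨(Real.neg_one_lt_tanh _).le, (Real.tanh_lt_one _).le⟩
    have hcpos := Real.cosh_pos (x * t)
    have hcosh : Real.exp |x * t| ≤ 2 * Real.cosh (x * t) := by
      rw [← Real.cosh_abs, Real.cosh_eq]
      linarith [Real.exp_pos (-|x * t|)]
    have hpow : |x * t| ^ k ≤ k.factorial * Real.exp |x * t| := by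
      have := Real.pow_div_factorial_le_exp |x * t| (abs_nonneg _) k
      rwa [div_le_iff₀' (by positivity)] at this
    have hdecay : |t| ^ k * (Real.cosh (x * t))⁻¹ ≤ (x ^ k)⁻¹ * (2 * (k.factorial : ℝ)) := by
      rw [← div_eq_mul_inv, div_le_iff₀ hcpos, mul_assoc, le_inv_mul_iff₀ (by positivity),
        ← mul_pow]
      calc (x * |t|) ^ k = |x * t| ^ k := by rw [abs_mul, abs_of_pos hx]
        _ ≤ k.factorial * Real.exp |x * t| := hpow
        _ ≤ k.factorial * (2 * Real.cosh (x * t)) := by gcongr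
        _ = _ := by ring
    rw [norm_mul, Real.norm_eq_abs t, Real.norm_eq_abs (_⁻¹), abs_of_pos (inv_pos.2 hcpos)]
    calc |t| ^ k * (‖P.eval (Real.tanh (x * t))‖ * (Real.cosh (x * t))⁻¹)
        = |t| ^ k * (Real.cosh (x * t))⁻¹ * ‖P.eval (Real.tanh (x * t))‖ := by ring
      _ ≤ _ := by
        gcongr
        exact hB _ htanh

lemma invCoshSchwartz_apply (x : ℝ) (hx : 0 < x) (t : ℝ) :
    invCoshSchwartz x hx t = (Real.cosh (x * t))⁻¹ := rfl

lemma exp_neg_le_invCosh {u : ℝ} (hu : 0 ≤ u) : Real.exp (-u) ≤ (Real.cosh u)⁻¹ := by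
  rw [Real.exp_neg]
  gcongr
  rw [Real.cosh_eq]
  linarith [Real.exp_le_exp.2 (show -u ≤ u by linarith)]

lemma AbsolutelyRegular.integrable_cexp_smul {X : Type*} [NormedAddCommGroup X]
    [NormedSpace ℂ X] {F : ℝ → X} (hF : AbsolutelyRegular F)
    (hneg : ∀ᵐ t : ℝ, t < 0 → F t = 0) {l : ℂ} (hl : 0 < l.re) :
    Integrable (fun t : ℝ => Complex.exp (-l * t) • F t) := by
  have hφ := hF.2.2 ((invCoshSchwartz l.re hl).postcompCLM Complex.ofRealCLM)
  refine hφ.mono ((Continuous.aestronglyMeasurable (by fun_prop)).smul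
    hF.1.aestronglyMeasurable) ?_
  filter_upwards [hneg] with t ht
  rcases lt_or_ge t 0 with h0 | h0
  · simp [ht h0]
  · rw [norm_smul, norm_smul, SchwartzMap.postcompCLM_apply, invCoshSchwartz_apply,
      Complex.norm_exp]
    gcongr
    have h := exp_neg_le_invCosh (mul_nonneg hl.le h0)
    simp only [Complex.ofRealCLM_apply, Complex.norm_real, Real.norm_eq_abs,
      abs_inv, abs_of_pos (Real.cosh_pos _)]
    simpa using h

lemma differentiable_intervalIntegral_cexp_smul {X : Type*} [NormedAddCommGroup X]
    [NormedSpace ℂ X] {f : ℝ → X} (hf : Continuous f) (a b : ℝ) :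
    Differentiable ℂ fun z : ℂ => ∫ t in a..b, Complex.exp (-z * t) • f t := by
  intro z₀
  have hcont (z : ℂ) : Continuous fun t : ℝ => Complex.exp (-z * t) • f t := by fun_prop
  have hcont' : Continuous fun p : ℂ × ℝ => (Complex.exp (-p.1 * p.2) * (-p.2)) • f p.2 := by
    fun_prop
  obtain ⟨B, hB⟩ := ((isCompact_closedBall z₀ 1).prod
    (isCompact_uIcc (a := a) (b := b))).exists_bound_of_continuousOn hcont'.continuousOn
  refine (intervalIntegral.hasDerivAt_integral_of_dominated_loc_of_deriv_le
    (F' := fun z t => (Complex.exp (-z * t) * (-t)) • f t) (bound := fun _ => B)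
    (Metric.ball_mem_nhds z₀ one_pos)
    (Eventually.of_forall fun z => (hcont z).aestronglyMeasurable)
    ((hcont z₀).intervalIntegrable _ _) (Continuous.aestronglyMeasurable (by fun_prop))
    (ae_of_all _ fun t ht z hz => ?_) (by simp) (ae_of_all _ fun t _ z _ => ?_)).2.differentiableAt
  · exact hB (z, t) ⟨Metric.ball_subset_closedBall hz, Set.uIoc_subset_uIcc ht⟩
  · refine HasDerivAt.smul_const ?_ (f t)
    have : HasDerivAt (fun z : ℂ => -z * (t : ℂ)) (-t) z := by
      simpa using (hasDerivAt_id z).neg.mul_const (t : ℂ)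
    exact this.cexp

/-- On the circle of radius `R`, the Newman kernel `1 + z² / R²` has modulus `2 |Re z| / R`. -/
lemma norm_one_add_sq_div_sq {R : ℝ} (hR : 0 < R) {z : ℂ} (hz : ‖z‖ = R) :
    ‖1 + z ^ 2 / (R : ℂ) ^ 2‖ = 2 * |z.re| / R := by
  have hRc : (R : ℂ) ≠ 0 := by exact_mod_cast hR.ne'
  have h : 1 + z ^ 2 / (R : ℂ) ^ 2 = z * ((2 * z.re : ℝ) : ℂ) / (R : ℂ) ^ 2 := by
    rw [← Complex.add_conj, mul_add, Complex.mul_conj, Complex.normSq_eq_norm_sq, hz]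
    field_simp
    push_cast
    ring
  rw [h, norm_div, norm_mul, norm_pow, Complex.norm_real, Complex.norm_real, hz,
    Real.norm_eq_abs, Real.norm_eq_abs, abs_mul, abs_of_pos hR, abs_two]
  field_simp

lemma norm_cexp_neg_mul_smul_le {X : Type*} [NormedAddCommGroup X] [NormedSpace ℂ X]
    {x : X} {M : ℝ} (hx : ‖x‖ ≤ M) (z : ℂ) (t : ℝ) :
    ‖Complex.exp (-z * t) • x‖ ≤ M * Real.exp (-z.re * t) := by
  rw [norm_smul, Complex.norm_exp, mul_comm]
  have : (-z * (t : ℂ)).re = -z.re * t := by simp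
  rw [this]
  gcongr

/-- A bounded function whose Laplace transform extends holomorphically to a disc around `0`
has bounded indefinite integral. -/
theorem exists_bound_integral_of_laplaceT_eq {X : Type*} [NormedAddCommGroup X]
    [NormedSpace ℂ X] {K : ℝ → X} (hK : Continuous K) {M : ℝ} (hM : ∀ t, ‖K t‖ ≤ M)
    {R : ℝ} (hR : 0 < R) {G : ℂ → X} (hG : DifferentiableOn ℂ G (Metric.closedBall 0 R))
    (hGK : ∀ z ∈ Metric.sphere (0 : ℂ) R, 0 < z.re → G z = laplaceT K z) :
    ∃ C, ∀ T, 0 ≤ T → ‖∫ t in (0 : ℝ)..T, K t‖ ≤ C := by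
  obtain ⟨B, hB⟩ := (isCompact_closedBall (0 : ℂ) R).exists_bound_of_continuousOn hG.continuousOn
  have hM0 : 0 ≤ M := (norm_nonneg _).trans (hM 0)
  have hzero : (0 : ℂ) ∈ Metric.closedBall (0 : ℂ) R := Metric.mem_closedBall_self hR.le
  have hB0 : 0 ≤ B := (norm_nonneg _).trans (hB 0 hzero)
  refine ⟨B + (2 * B + 2 * M / R), fun T hT => ?_⟩
  set gT : ℂ → X := fun z => ∫ t in (0 : ℝ)..T, Complex.exp (-z * t) • K t with hgT
  have hgTd : Differentiable ℂ gT := differentiable_intervalIntegral_cexp_smul hK 0 T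
  set Φ : ℂ → X := fun z => (Complex.exp (T * z) * (1 + z ^ 2 / (R : ℂ) ^ 2)) • (G z - gT z)
    with hΦ
  have hΦd : DiffContOnCl ℂ Φ (Metric.ball 0 R) := by
    refine DifferentiableOn.diffContOnCl_ball (U := Metric.closedBall 0 R) ?_ subset_rfl
    refine DifferentiableOn.smul (Differentiable.differentiableOn (by fun_prop)) ?_
    exact hG.sub hgTd.differentiableOn
  have hcont (z : ℂ) : Continuous fun t : ℝ => Complex.exp (-z * t) • K t := by fun_prop
  have hbd : ∀ z ∈ frontier (Metric.ball (0 : ℂ) R), ‖Φ z‖ ≤ 2 * B + 2 * M / R := by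
    intro z hz
    rw [frontier_ball _ hR.ne'] at hz
    have hzR : ‖z‖ = R := by simpa using hz
    have hnorm : ‖Φ z‖ = Real.exp (T * z.re) * (2 * |z.re| / R) * ‖G z - gT z‖ := by
      rw [hΦ]
      simp only
      rw [norm_smul, norm_mul, norm_one_add_sq_div_sq hR hzR, Complex.norm_exp]
      simp
    have hre : |z.re| ≤ R := hzR ▸ Complex.abs_re_le_norm z
    rw [hnorm]
    rcases lt_trichotomy z.re 0 with hneg | hz0 | hpos
    · have hg : ‖gT z‖ ≤ M * (Real.exp (-z.re * T) / -z.re) := by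
        calc ‖gT z‖ ≤ ∫ t in (0 : ℝ)..T, M * Real.exp (-z.re * t) :=
              intervalIntegral.norm_integral_le_of_norm_le hT
                (ae_of_all _ fun t _ => norm_cexp_neg_mul_smul_le (hM t) z t)
                (Continuous.intervalIntegrable (by fun_prop) _ _)
          _ = M * ((Real.exp (-z.re * T) - 1) / -z.re) := by
              rw [intervalIntegral.integral_const_mul,
                intervalIntegral.integral_comp_mul_left _ (by linarith : -z.re ≠ 0)]
              rw [smul_eq_mul, mul_zero, integral_exp, Real.exp_zero, div_eq_inv_mul]
          _ ≤ _ := by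
              have : 0 < -z.re := by linarith
              gcongr
              linarith
      have hexp : Real.exp (T * z.re) * Real.exp (-z.re * T) = 1 := by
        rw [← Real.exp_add]; simp; ring
      have hexp1 : Real.exp (T * z.re) ≤ 1 := by
        rw [Real.exp_le_one_iff]; nlinarith
      have hr2 : 2 * |z.re| / R ≤ 2 := by
        rw [div_le_iff₀ hR]; linarith
      have habs : |z.re| = -z.re := abs_of_neg hneg
      have hz' : z.re ≠ 0 := hneg.ne
      calc Real.exp (T * z.re) * (2 * |z.re| / R) * ‖G z - gT z‖
          ≤ Real.exp (T * z.re) * (2 * |z.re| / R) *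
            (B + M * (Real.exp (-z.re * T) / -z.re)) := by
            gcongr
            refine (norm_sub_le _ _).trans (add_le_add (hB z ?_) hg)
            simp [hzR]
        _ = Real.exp (T * z.re) * (2 * |z.re| / R) * B +
            (Real.exp (T * z.re) * Real.exp (-z.re * T)) * (2 * M / R) := by
            rw [habs, mul_add]; congr 1; field_simp
        _ ≤ 1 * 2 * B + 1 * (2 * M / R) := by
            rw [hexp]
            gcongr
        _ = _ := by ring
    · rw [hz0]
      simp
      positivity
    · have hint : IntegrableOn (fun t : ℝ => M * Real.exp (-z.re * t)) (Set.Ioi 0) :=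
        (integrableOn_exp_mul_Ioi (by linarith) 0).const_mul M
      have hintK : IntegrableOn (fun t : ℝ => Complex.exp (-z * t) • K t) (Set.Ioi 0) :=
        hint.mono' (hcont z).aestronglyMeasurable
          (ae_of_all _ fun t => norm_cexp_neg_mul_smul_le (hM t) z t)
      have hdiff : G z - gT z = ∫ t in Set.Ioi T, Complex.exp (-z * t) • K t := by
        rw [hGK z hz hpos, laplaceT, hgT, sub_eq_iff_eq_add',
          intervalIntegral.integral_interval_add_Ioi hintK
            (hintK.mono_set (Set.Ioi_subset_Ioi hT))]
      have hg : ‖G z - gT z‖ ≤ M * (Real.exp (-z.re * T) / z.re) := by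
        rw [hdiff]
        calc _ ≤ ∫ t in Set.Ioi T, M * Real.exp (-z.re * t) :=
              norm_integral_le_of_norm_le (hint.mono_set (Set.Ioi_subset_Ioi hT))
                (ae_of_all _ fun t => norm_cexp_neg_mul_smul_le (hM t) z t)
          _ = _ := by
              rw [integral_const_mul, integral_exp_mul_Ioi (by linarith), neg_div_neg_eq]
      have hexp : Real.exp (T * z.re) * Real.exp (-z.re * T) = 1 := by
        rw [← Real.exp_add]; simp; ring
      calc Real.exp (T * z.re) * (2 * |z.re| / R) * ‖G z - gT z‖
          ≤ Real.exp (T * z.re) * (2 * |z.re| / R) * (M * (Real.exp (-z.re * T) / z.re)) := by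
            gcongr
        _ = (Real.exp (T * z.re) * Real.exp (-z.re * T)) * (2 * M / R) := by
            rw [abs_of_pos hpos]; field_simp
        _ ≤ _ := by rw [hexp]; linarith
  have hmax := Complex.norm_le_of_forall_mem_frontier_norm_le Metric.isBounded_ball hΦd hbd
    (subset_closure (Metric.mem_ball_self hR))
  have hΦ0 : Φ 0 = G 0 - ∫ t in (0 : ℝ)..T, K t := by simp [hΦ, hgT]
  rw [hΦ0] at hmax
  calc ‖∫ t in (0 : ℝ)..T, K t‖ = ‖G 0 - (G 0 - ∫ t in (0 : ℝ)..T, K t)‖ := by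
        rw [sub_sub_cancel]
    _ ≤ _ := (norm_sub_le _ _).trans (add_le_add (hB 0 hzero) hmax)

/-- The increments over intervals of length at most one of a uniformly continuous function on the
line are uniformly bounded. -/
lemma UniformContinuous.exists_norm_sub_le {X : Type*} [NormedAddCommGroup X] {Q : ℝ → X}
    (hQ : UniformContinuous Q) : ∃ C, ∀ t h, 0 ≤ h → h ≤ 1 → ‖Q (t + h) - Q t‖ ≤ C := by
  obtain ⟨δ, hδ, hQδ⟩ := Metric.uniformContinuous_iff.1 hQ 1 one_pos
  obtain ⟨n, hn⟩ := exists_nat_one_div_lt hδ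
  have hstep : ∀ t h, 0 ≤ h → h < δ → ∀ m : ℕ, ‖Q (t + m * h) - Q t‖ ≤ m := by
    intro t h h0 hh m
    induction m with
    | zero => simp
    | succ m ih =>
      have h1 : ‖Q (t + (m + 1 : ℕ) * h) - Q (t + m * h)‖ ≤ 1 := by
        rw [← dist_eq_norm]
        refine (hQδ ?_).le
        rw [Real.dist_eq]
        push_cast
        rw [show t + (m + 1) * h - (t + m * h) = h by ring, abs_of_nonneg h0]
        exact hh
      calc _ = ‖(Q (t + (m + 1 : ℕ) * h) - Q (t + m * h)) + (Q (t + m * h) - Q t)‖ := by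
            rw [sub_add_sub_cancel]
        _ ≤ 1 + m := (norm_add_le _ _).trans (add_le_add h1 ih)
        _ = _ := by push_cast; ring
  refine ⟨(n + 1 : ℕ), fun t h h0 h1 => ?_⟩
  have hn0 : (0 : ℝ) < n + 1 := by positivity
  have := hstep t (h / (n + 1)) (by positivity)
    (lt_of_le_of_lt (by gcongr) hn) (n + 1)
  rwa [show ((n + 1 : ℕ) : ℝ) * (h / (n + 1)) = h by push_cast; field_simp] at this

lemma integral_eq_zero_of_nonpos {X : Type*} [NormedAddCommGroup X] [NormedSpace ℝ X]
    {F : ℝ → X} (hneg : ∀ᵐ t : ℝ, t < 0 → F t = 0) {t : ℝ} (ht : t ≤ 0) :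
    ∫ s in (0 : ℝ)..t, F s = 0 := by
  refine intervalIntegral.integral_zero_ae ?_
  filter_upwards [hneg, Measure.ae_ne volume (0 : ℝ)] with s hs hs0 hst
  rw [Set.uIoc_of_ge ht] at hst
  exact hs (lt_of_le_of_ne hst.2 hs0)

/-- The Laplace transform of the unit increments of an indefinite integral. -/
lemma laplaceT_integral_sub {X : Type*} [NormedAddCommGroup X] [NormedSpace ℂ X]
    [CompleteSpace X] {F : ℝ → X} (hF : LocallyIntegrable F)
    (hneg : ∀ᵐ t : ℝ, t < 0 → F t = 0) {l : ℂ}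
    (hint : Integrable fun t : ℝ => Complex.exp (-l * t) • F t) :
    laplaceT (fun t => (∫ s in (0 : ℝ)..t, F s) - ∫ s in (0 : ℝ)..(t - 1), F s) l =
      (∫ t in (0 : ℝ)..1, Complex.exp (-l * t) • (1 : ℂ)) • laplaceT F l := by
  have hii (a b : ℝ) : IntervalIntegrable F volume a b := (hF.integrableOn_isCompact isCompact_uIcc).intervalIntegrable
  set k : ℝ → ℂ := (Set.Ioc (0 : ℝ) 1).indicator fun t => Complex.exp (-l * t) with hk
  have hkint : Integrable k := by
    rw [hk, integrable_indicator_iff measurableSet_Ioc]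
    exact (Continuous.integrableOn_Icc (by fun_prop)).mono_set Set.Ioc_subset_Icc_self
  have hconv (t : ℝ) : convolution k (fun t : ℝ => Complex.exp (-l * t) • F t)
      (ContinuousLinearMap.lsmul ℝ ℂ) volume t = Complex.exp (-l * t) •
        ((∫ s in (0 : ℝ)..t, F s) - ∫ s in (0 : ℝ)..(t - 1), F s) := by
    rw [convolution_def]
    have h1 : ∀ s, ContinuousLinearMap.lsmul ℝ ℂ (k s)
        (Complex.exp (-l * (t - s : ℝ)) • F (t - s)) =
        (Set.Ioc (0 : ℝ) 1).indicator (fun s => Complex.exp (-l * t) • F (t - s)) s := by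
      intro s
      by_cases hs : s ∈ Set.Ioc (0 : ℝ) 1
      · rw [hk, Set.indicator_of_mem hs, Set.indicator_of_mem hs,
          ContinuousLinearMap.lsmul_apply, smul_smul, ← Complex.exp_add]
        congr 2
        push_cast; ring
      · rw [hk, Set.indicator_of_notMem hs, Set.indicator_of_notMem hs]
        simp
    simp_rw [h1]
    rw [integral_indicator measurableSet_Ioc, integral_smul,
      ← intervalIntegral.integral_of_le zero_le_one,
      intervalIntegral.integral_comp_sub_left (fun s => F s) t, sub_zero,
      intervalIntegral.integral_interval_sub_left (hii _ _) (hii _ _)]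
  have hL : ∀ f : ℝ → X, (∀ᵐ t : ℝ, t < 0 → f t = 0) →
      laplaceT f l = ∫ t : ℝ, Complex.exp (-l * t) • f t := by
    intro f hf
    rw [laplaceT, setIntegral_eq_integral_of_ae_compl_eq_zero]
    filter_upwards [hf, Measure.ae_ne volume (0 : ℝ)] with s hs hs0 hs1
    rw [hs (lt_of_le_of_ne (not_lt.1 hs1) hs0), smul_zero]
  rw [hL F hneg, hL _ (ae_of_all _ fun t ht => by
    rw [integral_eq_zero_of_nonpos hneg ht.le,
      integral_eq_zero_of_nonpos hneg (by linarith : t - 1 ≤ 0), sub_zero])]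
  simp_rw [← hconv]
  rw [integral_convolution _ hkint hint, ContinuousLinearMap.lsmul_apply, hk,
    integral_indicator measurableSet_Ioc, intervalIntegral.integral_of_le zero_le_one]
  simp

/-- If `F` is absolutely regular, vanishes a.e. on the negative half-line,
`0` is a regular point for `𝓛F`, and the indefinite integral `PF` is uniformly continuous on
`[0,∞)`, then `PF` is bounded on `[0,∞)` and `F` is ergodic on `ℝ₊` with mean `0`. -/
theorem indefInt_bounded_and_ergodic_halfline {X : Type*} [NormedAddCommGroup X]
    [NormedSpace ℂ X] [CompleteSpace X] (F : ℝ → X) (hF : AbsolutelyRegular F)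
    (hneg : ∀ᵐ t : ℝ, t < 0 → F t = 0)
    (hreg : LaplaceRegularAt F 0)
    (hPF : UniformContinuousOn (fun t => ∫ s in (0:ℝ)..t, F s) (Set.Ici (0:ℝ))) :
    (∃ C : ℝ, ∀ t : ℝ, 0 ≤ t → ‖∫ s in (0:ℝ)..t, F s‖ ≤ C) ∧
    (∀ ε : ℝ, 0 < ε → ∃ T₀ : ℝ, 0 < T₀ ∧ ∀ T : ℝ, T₀ ≤ T → ∀ t : ℝ, 0 ≤ t →
      ‖T⁻¹ • ∫ s in (0:ℝ)..T, F (t + s)‖ < ε) := by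
  have hii (a b : ℝ) : IntervalIntegrable F volume a b := (hF.2.1.integrableOn_isCompact isCompact_uIcc).intervalIntegrable
  have hbound : ∃ C : ℝ, ∀ t : ℝ, 0 ≤ t → ‖∫ s in (0:ℝ)..t, F s‖ ≤ C := by
    set Q : ℝ → X := fun t => ∫ s in (0:ℝ)..t, F s
    have hQneg : ∀ t ≤ 0, Q t = 0 := fun t ht => integral_eq_zero_of_nonpos hneg ht
    have hQ : UniformContinuous Q := by
      have hmax : Q = fun t => Q (max t 0) := by
        funext t
        rcases le_total t 0 with h | h
        · rw [max_eq_right h, hQneg t h, hQneg 0 le_rfl]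
        · rw [max_eq_left h]
      rw [hmax, ← uniformContinuousOn_univ]
      exact hPF.comp ((LipschitzWith.id.max_const 0).uniformContinuous.uniformContinuousOn)
        fun t _ => le_max_right t 0
    obtain ⟨M, hM⟩ := hQ.exists_norm_sub_le
    obtain ⟨U, hU, h0U, g, hg, hgF⟩ := hreg
    rw [Complex.ofReal_zero, mul_zero] at h0U
    obtain ⟨R, hR, hRU⟩ := Metric.nhds_basis_closedBall.mem_iff.1 (hU.mem_nhds h0U)
    obtain ⟨C, hC⟩ := exists_bound_integral_of_laplaceT_eq (K := fun t => Q t - Q (t - 1))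
      (M := M) (hQ.continuous.sub (hQ.continuous.comp (by fun_prop)))
      (fun t => by simpa using hM (t - 1) 1 zero_le_one le_rfl) hR
      (G := fun z => (∫ t in (0 : ℝ)..1, Complex.exp (-z * t) • (1 : ℂ)) • g z)
      (((differentiable_intervalIntegral_cexp_smul continuous_const 0 1).differentiableOn).smul
        (hg.mono hRU))
      (fun z hz hpos => by
        rw [laplaceT_integral_sub hF.2.1 hneg (hF.integrable_cexp_smul hneg hpos),
          hgF z (hRU (Metric.sphere_subset_closedBall hz)) hpos])
    have hQi (a b : ℝ) : IntervalIntegrable Q volume a b := hQ.continuous.intervalIntegrable a b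
    refine ⟨M + (C + ‖∫ t in (-1 : ℝ)..0, Q t‖), fun T hT => ?_⟩
    have hsplit : ∫ t in (0 : ℝ)..T, (Q t - Q (t - 1)) =
        (∫ t in (T - 1)..T, Q t) - ∫ t in (-1 : ℝ)..0, Q t := by
      have hQshift : Continuous fun t : ℝ => Q (t - 1) := hQ.continuous.comp (by fun_prop)
      rw [intervalIntegral.integral_sub (hQi _ _) (hQshift.intervalIntegrable _ _),
        intervalIntegral.integral_comp_sub_right, zero_sub,
        intervalIntegral.integral_interval_sub_interval_comm' (hQi _ _) (hQi _ _) (hQi _ _)]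
    have hmean : ‖Q T - ∫ t in (T - 1)..T, Q t‖ ≤ M := by
      have : Q T - ∫ t in (T - 1)..T, Q t = ∫ t in (T - 1)..T, (Q T - Q t) := by
        rw [intervalIntegral.integral_sub (by simp) (hQi _ _)]
        simp
      rw [this]
      refine (intervalIntegral.norm_integral_le_of_norm_le_const (C := M) fun t ht => ?_).trans
        (by simp)
      rw [Set.uIoc_of_le (by linarith)] at ht
      simpa using hM t (T - t) (by linarith [ht.2]) (by linarith [ht.1])
    calc ‖Q T‖ = ‖(Q T - ∫ t in (T - 1)..T, Q t) + ((∫ t in (0 : ℝ)..T, (Q t - Q (t - 1))) +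
          ∫ t in (-1 : ℝ)..0, Q t)‖ := by rw [hsplit]; congr 1; abel
      _ ≤ _ := (norm_add_le _ _).trans
        (add_le_add hmean ((norm_add_le _ _).trans (add_le_add (hC T hT) le_rfl)))
  refine ⟨hbound, fun ε hε => ?_⟩
  obtain ⟨C, hC⟩ := hbound
  have hC0 : 0 ≤ C := (norm_nonneg _).trans (hC 0 le_rfl)
  refine ⟨2 * C / ε + 1, by positivity, fun T hT t ht => ?_⟩
  have hTpos : 0 < T := lt_of_lt_of_le (by positivity) hT
  rw [intervalIntegral.integral_comp_add_left (fun s => F s) t, add_zero,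
    ← intervalIntegral.integral_interval_sub_left (hii 0 _) (hii 0 _), norm_smul, norm_inv,
    Real.norm_of_nonneg hTpos.le, inv_mul_lt_iff₀ hTpos]
  calc _ ≤ C + C := (norm_sub_le _ _).trans (add_le_add (hC _ (by linarith)) (hC t ht))
    _ < T * ε := by
      have : 2 * C / ε < T := by linarith
      rw [div_lt_iff₀ hε] at this
      linarith
end
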